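/- The set of dominant Lyndon words is exactly L⁺ = { (i, i+1, …, j) : 1 ≤ i ≤ j ≤ n } ∪ { (i, …, n−1, n, n, n−1, …, j) : 1 ≤ i < j ≤ n }. -/

import Mathlib

namespace SpinQHA

/-- The coefficient field `ℚ(q)`. -/
abbrev Kq : Type := RatFunc ℚ

/-- The variable `q`. -/
noncomputable def qX : Kq := RatFunc.X

/-- Parity of the letter `i`.  The alphabet is `Fin (n+2)` (so the rank is `n+2 ≥ 2`);
the index `i` represents the letter `i+1`, and the last letter is the unique odd one. -/
def pa (n : ℕ) (i : Fin (n+2)) : ℕ := if (i : ℕ) = n+1 then 1 else 0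

/-- Symmetrized Cartan matrix of `osp(1|2(n+2))`. -/
def cart (n : ℕ) (i j : Fin (n+2)) : ℤ :=
  if i = j then (if (i : ℕ) = n+1 then 2 else 4)
  else if (i : ℕ) + 1 = (j : ℕ) ∨ (j : ℕ) + 1 = (i : ℕ) then -2 else 0

/-- Bilinear form on `Q⁺` (elements recorded by their coordinates). -/
def bil (n : ℕ) (μ ν : Fin (n+2) → ℕ) : ℤ :=
  ∑ i, ∑ j, (μ i : ℤ) * (ν j : ℤ) * cart n i j

/-- Weight `|w| ∈ Q⁺` of a word. -/
def wt (n : ℕ) (w : List (Fin (n+2))) : Fin (n+2) → ℕ := fun i => w.count i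

/-- Parity (as a natural number, read mod 2) of a word. -/
def pw (n : ℕ) (w : List (Fin (n+2))) : ℕ := (w.map (pa n)).sum

/-- `F`, the free `ℚ(q)`-module on the set of words. -/
abbrev F (n : ℕ) : Type := List (Fin (n+2)) →₀ Kq

/-- Quantum shuffle of two words, computed in the "reversed" representation where the
head of each list is the *last* letter of the corresponding word; this encodes the
inductive rule `(xi) ⋄ (yj) = (x ⋄ (yj))i + (-1)^{p(xi)p(j)} q^{-(|xi|,|j|)} ((xi) ⋄ y)j`. -/
noncomputable def shAux (n : ℕ) : List (Fin (n+2)) → List (Fin (n+2)) → F n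
  | [], y => Finsupp.single y 1
  | x, [] => Finsupp.single x 1
  | i :: x, j :: y =>
      Finsupp.mapDomain (List.cons i) (shAux n x (j :: y))
      + ((-1 : Kq) ^ (pw n (i :: x) * pa n j)
          * qX ^ (-(bil n (wt n (i :: x)) (wt n [j])))) •
          Finsupp.mapDomain (List.cons j) (shAux n (i :: x) y)
  termination_by x y => x.length + y.length

/-- Quantum shuffle product of two words. -/
noncomputable def shw (n : ℕ) (x y : List (Fin (n+2))) : F n :=
  Finsupp.mapDomain List.reverse (shAux n x.reverse y.reverse)

/-- The quantum shuffle product `⋄` on `F`, extended bilinearly. -/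
noncomputable def diam (n : ℕ) (u v : F n) : F n :=
  u.sum fun x cx => v.sum fun y cy => (cx * cy) • shw n x y

/-- Strict lexicographic order `≺` on words. -/
def wlt (n : ℕ) (v w : List (Fin (n+2))) : Prop := List.Lex (· < ·) v w

/-- A word is Lyndon if it is nonempty and lexicographically smaller than each of its
proper nonempty suffixes. -/
def IsLyndonW (n : ℕ) (w : List (Fin (n+2))) : Prop :=
  w ≠ [] ∧ ∀ s t : List (Fin (n+2)), w = s ++ t → s ≠ [] → t ≠ [] → wlt n w t

/-- Iterated shuffle products of one-letter words. -/
noncomputable def prodLetters (n : ℕ) : List (Fin (n+2)) → F n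
  | [] => Finsupp.single [] 1
  | i :: l => diam n (Finsupp.single [i] 1) (prodLetters n l)

/-- `U`, the subalgebra of `(F,⋄)` generated by the one-letter words, realized as the
`ℚ(q)`-span of all iterated shuffle products of letters. -/
noncomputable def Ualg (n : ℕ) : Submodule Kq (F n) :=
  Submodule.span Kq (Set.range (prodLetters n))

/-- `w = max(u)`: `w` is the lexicographically largest word occurring in `u` with
nonzero coefficient. -/
def IsMaxWord (n : ℕ) (u : F n) (w : List (Fin (n+2))) : Prop :=
  w ∈ u.support ∧ ∀ v ∈ u.support, v = w ∨ wlt n v w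

/-- A word is dominant if it is the largest word of some `u ∈ U`. -/
def IsDominant (n : ℕ) (w : List (Fin (n+2))) : Prop :=
  ∃ u ∈ Ualg n, IsMaxWord n u w

/-- The ascending word `(i, i+1, …, j)` (empty if `j < i`). -/
def asc (n : ℕ) (i j : Fin (n+2)) : List (Fin (n+2)) :=
  (List.finRange (n+2)).filter (fun k => decide (i ≤ k ∧ k ≤ j))

/-- The dominant Lyndon word `ι⁺(α(i,j)) = (i, i+1, …, j)`, for `i ≤ j`. -/
def lynA (n : ℕ) (i j : Fin (n+2)) : List (Fin (n+2)) := asc n i j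

/-- The dominant Lyndon word `ι⁺(β(i,j)) = (i, …, n-1, n, n, n-1, …, j)`, for `i < j`
(the letter `n` of the paper is the last letter of our alphabet `Fin (n+2)`). -/
def lynB (n : ℕ) (i j : Fin (n+2)) : List (Fin (n+2)) :=
  asc n i (Fin.last (n+1)) ++ (asc n j (Fin.last (n+1))).reverse

open Finsupp

noncomputable instance natAlgebraKq : Algebra ℕ Kq := Semiring.toNatAlgebra

noncomputable instance intAlgebraKq : Algebra ℤ Kq := Ring.toIntAlgebra _

/-- The braiding scalar `(-1)^{p(i)p(j)} q^{-(αᵢ,αⱼ)}`. -/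
noncomputable def chi (n : ℕ) (i j : Fin (n+2)) : Kq :=
  (-1) ^ (pa n i * pa n j) * qX ^ (-(cart n i j))

/-- The braiding scalar of a word with a letter. -/
noncomputable def tw (n : ℕ) (c : Fin (n+2)) (w : List (Fin (n+2))) : Kq :=
  (w.map fun i => chi n i c).prod

@[simp] theorem tw_nil (n : ℕ) (c : Fin (n+2)) : tw n c [] = 1 := rfl

@[simp] theorem tw_cons (n : ℕ) (c i : Fin (n+2)) (w : List (Fin (n+2))) :
    tw n c (i :: w) = chi n i c * tw n c w := by simp [tw]

@[simp] theorem tw_append (n : ℕ) (c : Fin (n+2)) (v w : List (Fin (n+2))) :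
    tw n c (v ++ w) = tw n c v * tw n c w := by simp [tw]

@[simp] theorem tw_reverse (n : ℕ) (c : Fin (n+2)) (w : List (Fin (n+2))) :
    tw n c w.reverse = tw n c w := by
  simp [tw, List.map_reverse, List.prod_reverse]

theorem qX_ne_zero : qX ≠ 0 := RatFunc.X_ne_zero

theorem chi_comm (n : ℕ) (i j : Fin (n+2)) : chi n i j = chi n j i := by
  have h : cart n i j = cart n j i := by
    unfold cart
    by_cases h : i = j
    · subst h; rfl
    · simp only [h, Ne.symm h, if_false, or_comm]
  rw [chi, chi, h, mul_comm (pa n i)]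

theorem bil_wt_singleton (n : ℕ) (w : List (Fin (n+2))) (j : Fin (n+2)) :
    bil n (wt n w) (wt n [j]) = (w.map fun i => cart n i j).sum := by
  have h : ∀ i, ∑ k, (wt n w i : ℤ) * (wt n [j] k : ℤ) * cart n i k
      = (w.count i : ℤ) * cart n i j := by
    intro i
    rw [Finset.sum_eq_single j]
    · simp [wt]
    · intro b _ hb
      simp [wt, Ne.symm hb]
    · simp
  rw [bil, Finset.sum_congr rfl fun i _ => h i]
  induction w with
  | nil => simp
  | cons a w ih =>
    have ih' := ih (by
      intro i
      rw [Finset.sum_eq_single j]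
      · simp [wt]
      · intro b _ hb
        simp [wt, Ne.symm hb]
      · simp)
    rw [List.map_cons, List.sum_cons, ← ih']
    simp only [List.count_cons, Nat.cast_add, add_mul, Finset.sum_add_distrib]
    rw [add_comm]
    congr 1
    simp

theorem shAux_scalar (n : ℕ) (w : List (Fin (n+2))) (j : Fin (n+2)) :
    (-1 : Kq) ^ (pw n w * pa n j) * qX ^ (-(bil n (wt n w) (wt n [j]))) = tw n j w := by
  rw [bil_wt_singleton]
  induction w with
  | nil => simp [pw]
  | cons a w ih =>
    rw [tw_cons, ← ih, chi, pw, pw, List.map_cons, List.map_cons, List.sum_cons, List.sum_cons,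
      add_mul, pow_add, neg_add, zpow_add₀ qX_ne_zero]
    ring

/-- A word as a basis vector. -/
noncomputable def wd (n : ℕ) (w : List (Fin (n+2))) : F n := single w 1

/-- Appending a letter to all words. -/
noncomputable def app (n : ℕ) (k : Fin (n+2)) : F n →ₗ[Kq] F n :=
  Finsupp.lmapDomain Kq Kq (fun w => w ++ [k])

/-- Deleting a given last letter. -/
noncomputable def del (n : ℕ) (i : Fin (n+2)) : F n →ₗ[Kq] F n :=
  Finsupp.lcomapDomain (fun w => w ++ [i]) (List.append_left_injective [i])

/-- Left shuffle multiplication by a letter. -/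
noncomputable def lmul (n : ℕ) (j : Fin (n+2)) : F n →ₗ[Kq] F n :=
  Finsupp.linearCombination Kq (fun w => shw n [j] w)

/-- Right shuffle multiplication by a letter. -/
noncomputable def rmul (n : ℕ) (c : Fin (n+2)) : F n →ₗ[Kq] F n :=
  Finsupp.linearCombination Kq (fun w => shw n w [c])

/-- The diagonal operator scaling each word by its braiding scalar with `c`. -/
noncomputable def twist (n : ℕ) (c : Fin (n+2)) : F n →ₗ[Kq] F n :=
  Finsupp.linearCombination Kq (fun w => tw n c w • wd n w)

theorem del_apply (n : ℕ) (i : Fin (n+2)) (u : F n) (w : List (Fin (n+2))) :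
    del n i u w = u (w ++ [i]) := rfl

@[simp] theorem app_wd (n : ℕ) (k : Fin (n+2)) (w : List (Fin (n+2))) :
    app n k (wd n w) = wd n (w ++ [k]) := by
  simp [app, wd]

theorem del_app (n : ℕ) (i k : Fin (n+2)) (u : F n) :
    del n i (app n k u) = if i = k then u else 0 := by
  ext w
  rw [del_apply]
  split_ifs with h
  · subst h
    exact Finsupp.mapDomain_apply (List.append_left_injective [i]) u w
  · refine Finsupp.mapDomain_of_notMem_range _ _ ?_
    rintro ⟨v, hv⟩
    have := (List.append_inj' hv rfl).2
    simp_all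

@[simp] theorem del_wd_nil (n : ℕ) (i : Fin (n+2)) : del n i (wd n []) = 0 := by
  ext w
  rw [del_apply, wd, Finsupp.single_apply, if_neg (by simp)]
  rfl

theorem linearMap_ext_wd {n : ℕ} {f g : F n →ₗ[Kq] F n} (h : ∀ w, f (wd n w) = g (wd n w)) :
    f = g := Finsupp.lhom_ext' fun w => LinearMap.ext_ring (h w)

theorem linearMap_ext_snoc {n : ℕ} {f g : F n →ₗ[Kq] F n} (h0 : f (wd n []) = g (wd n []))
    (h1 : ∀ k w, f (wd n w) = g (wd n w) → f (app n k (wd n w)) = g (app n k (wd n w))) :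
    f = g := by
  refine linearMap_ext_wd fun w => ?_
  induction w using List.reverseRecOn with
  | nil => exact h0
  | append_singleton w k ih => rw [← app_wd]; exact h1 k w ih

theorem shw_snoc (n : ℕ) (x y : List (Fin (n+2))) (i j : Fin (n+2)) :
    shw n (x ++ [i]) (y ++ [j]) = app n i (shw n x (y ++ [j]))
      + tw n j (x ++ [i]) • app n j (shw n (x ++ [i]) y) := by
  have key : ∀ (k : Fin (n+2)) (u : F n),
      mapDomain List.reverse (mapDomain (List.cons k) u) = app n k (mapDomain List.reverse u) := by
    intro k u
    rw [app, Finsupp.lmapDomain_apply, ← Finsupp.mapDomain_comp, ← Finsupp.mapDomain_comp]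
    congr 1
    ext1 w
    simp
  unfold shw
  simp only [List.reverse_append, List.reverse_singleton, List.singleton_append]
  rw [shAux, shAux_scalar, Finsupp.mapDomain_add, Finsupp.mapDomain_smul, key, key]
  simp [mul_comm]

theorem shw_nil_left (n : ℕ) (y : List (Fin (n+2))) : shw n [] y = wd n y := by
  simp [shw, shAux, wd]

theorem shw_nil_right (n : ℕ) (x : List (Fin (n+2))) : shw n x [] = wd n x := by
  unfold shw
  rcases h : x.reverse with _ | ⟨i, y⟩
  · simp_all [shAux, wd]
  · rw [List.reverse_nil, shAux, mapDomain_single, ← h, List.reverse_reverse]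
    · rfl
    · simp

theorem lmul_wd (n : ℕ) (j : Fin (n+2)) (w : List (Fin (n+2))) :
    lmul n j (wd n w) = shw n [j] w := by simp [lmul, wd]

theorem rmul_wd (n : ℕ) (j : Fin (n+2)) (w : List (Fin (n+2))) :
    rmul n j (wd n w) = shw n w [j] := by simp [rmul, wd]

theorem twist_wd (n : ℕ) (j : Fin (n+2)) (w : List (Fin (n+2))) :
    twist n j (wd n w) = tw n j w • wd n w := by simp [twist, wd]

@[simp] theorem lmul_nil (n : ℕ) (j : Fin (n+2)) : lmul n j (wd n []) = wd n [j] := by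
  rw [lmul_wd, shw_nil_right]

@[simp] theorem rmul_nil (n : ℕ) (j : Fin (n+2)) : rmul n j (wd n []) = wd n [j] := by
  rw [rmul_wd, shw_nil_left]

@[simp] theorem twist_nil (n : ℕ) (j : Fin (n+2)) : twist n j (wd n []) = wd n [] := by
  simp [twist_wd]

theorem lmul_app (n : ℕ) (j k : Fin (n+2)) (u : F n) :
    lmul n j (app n k u) = app n j (app n k u) + chi n j k • app n k (lmul n j u) := by
  have : lmul n j ∘ₗ app n k = app n j ∘ₗ app n k + chi n j k • (app n k ∘ₗ lmul n j) := by
    refine linearMap_ext_wd fun w => ?_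
    have := shw_snoc n [] w j k
    simp only [List.nil_append, shw_nil_left] at this
    simp [lmul_wd, this]
  exact LinearMap.congr_fun this u

theorem twist_app (n : ℕ) (c k : Fin (n+2)) (u : F n) :
    twist n c (app n k u) = chi n k c • app n k (twist n c u) := by
  have : twist n c ∘ₗ app n k = chi n k c • (app n k ∘ₗ twist n c) := by
    refine linearMap_ext_wd fun w => ?_
    simp [twist_wd, smul_smul, mul_comm]
  exact LinearMap.congr_fun this u

theorem rmul_app (n : ℕ) (c k : Fin (n+2)) (u : F n) :
    rmul n c (app n k u) = app n k (rmul n c u)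
      + chi n k c • app n c (app n k (twist n c u)) := by
  have : rmul n c ∘ₗ app n k
      = app n k ∘ₗ rmul n c + chi n k c • (app n c ∘ₗ app n k ∘ₗ twist n c) := by
    refine linearMap_ext_wd fun w => ?_
    have := shw_snoc n w [] k c
    simp only [List.nil_append, shw_nil_right] at this
    simp [rmul_wd, this, twist_wd, smul_smul, mul_comm]
  exact LinearMap.congr_fun this u

theorem del_lmul (n : ℕ) (i j : Fin (n+2)) (u : F n) :
    del n i (lmul n j u) = (if i = j then u else 0) + chi n j i • lmul n j (del n i u) := by
  have : del n i ∘ₗ lmul n j = (if i = j then LinearMap.id else 0)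
      + chi n j i • (lmul n j ∘ₗ del n i) := by
    refine linearMap_ext_snoc ?_ fun k w _ => ?_
    · have := del_app n i j (wd n [])
      simp only [app_wd, List.nil_append] at this
      simp only [LinearMap.comp_apply, lmul_nil, LinearMap.add_apply, LinearMap.smul_apply,
        del_wd_nil, map_zero, smul_zero, add_zero, this]
      split_ifs <;> rfl
    · simp only [LinearMap.comp_apply, LinearMap.add_apply, LinearMap.smul_apply, lmul_app,
        map_add, map_smul, del_app]
      split_ifs <;> simp_all
  have h := LinearMap.congr_fun this u
  simp only [LinearMap.comp_apply, LinearMap.add_apply, LinearMap.smul_apply] at h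
  rw [h]
  split_ifs <;> rfl

theorem twist_lmul (n : ℕ) (c j : Fin (n+2)) (u : F n) :
    twist n c (lmul n j u) = chi n j c • lmul n j (twist n c u) := by
  have : twist n c ∘ₗ lmul n j = chi n j c • (lmul n j ∘ₗ twist n c) := by
    refine linearMap_ext_snoc ?_ fun k w ih => ?_
    · simp [twist_wd]
    · simp only [LinearMap.comp_apply, LinearMap.smul_apply] at ih ⊢
      simp only [lmul_app, twist_app, map_add, map_smul, ih]
      module
  exact LinearMap.congr_fun this u

theorem lmul_rmul (n : ℕ) (c j : Fin (n+2)) (u : F n) :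
    lmul n j (rmul n c u) = rmul n c (lmul n j u) := by
  have : lmul n j ∘ₗ rmul n c = rmul n c ∘ₗ lmul n j := by
    refine linearMap_ext_snoc ?_ fun k w ih => ?_
    · have h1 := lmul_app n j c (wd n [])
      have h2 := rmul_app n c j (wd n [])
      simp only [app_wd, List.nil_append, lmul_nil, rmul_nil, twist_nil] at h1 h2
      simp [h1, h2]
    · simp only [LinearMap.comp_apply] at ih ⊢
      simp only [lmul_app, rmul_app, twist_app, map_add, map_smul, ih, twist_lmul]
      module
  exact LinearMap.congr_fun this u

theorem prodLetters_cons (n : ℕ) (i : Fin (n+2)) (l : List (Fin (n+2))) :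
    prodLetters n (i :: l) = lmul n i (prodLetters n l) := by
  simp [prodLetters, diam, lmul, Finsupp.linearCombination_apply]

theorem prodLetters_nil (n : ℕ) : prodLetters n [] = wd n [] := rfl

theorem prodLetters_mem (n : ℕ) (l : List (Fin (n+2))) : prodLetters n l ∈ Ualg n :=
  Submodule.subset_span ⟨l, rfl⟩

theorem Ualg_le_comap {n : ℕ} {f : F n →ₗ[Kq] F n} {S : Submodule Kq (F n)}
    (h : ∀ l, f (prodLetters n l) ∈ S) {u : F n} (hu : u ∈ Ualg n) : f u ∈ S := by
  have : Ualg n ≤ S.comap f := by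
    rw [Ualg, Submodule.span_le]
    rintro _ ⟨l, rfl⟩
    exact h l
  exact this hu

theorem lmul_mem {n : ℕ} (j : Fin (n+2)) {u : F n} (hu : u ∈ Ualg n) : lmul n j u ∈ Ualg n :=
  Ualg_le_comap (fun l => by rw [← prodLetters_cons]; exact prodLetters_mem n _) hu

theorem rmul_mem {n : ℕ} (c : Fin (n+2)) {u : F n} (hu : u ∈ Ualg n) : rmul n c u ∈ Ualg n := by
  refine Ualg_le_comap (fun l => ?_) hu
  induction l with
  | nil =>
    have := prodLetters_mem n [c]
    rwa [prodLetters_cons, prodLetters_nil, lmul_nil, ← rmul_nil] at this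
  | cons i l ih =>
    rw [prodLetters_cons, ← lmul_rmul]
    exact lmul_mem i ih

theorem del_mem {n : ℕ} (c : Fin (n+2)) {u : F n} (hu : u ∈ Ualg n) : del n c u ∈ Ualg n := by
  refine Ualg_le_comap (fun l => ?_) hu
  induction l with
  | nil => simp [prodLetters_nil]
  | cons i l ih =>
    rw [prodLetters_cons, del_lmul]
    refine add_mem ?_ (Submodule.smul_mem _ _ (lmul_mem i ih))
    split_ifs
    · exact prodLetters_mem n l
    · exact zero_mem _

/-- The square `q²` of the variable. -/
noncomputable def qsq : Kq := qX ^ 2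

theorem qsq_ne_zero : qsq ≠ 0 := pow_ne_zero _ qX_ne_zero

theorem algebraMap_ne_zero_of_coeff {p : Polynomial ℚ} (hp : p.coeff 4 ≠ 0) :
    algebraMap (Polynomial ℚ) Kq p ≠ 0 := by
  refine (map_ne_zero_iff _ (RatFunc.algebraMap_injective ℚ)).2 fun h => hp ?_
  rw [h, Polynomial.coeff_zero]

theorem qsq_sub_inv_ne_zero : qsq - qsq⁻¹ ≠ 0 := by
  have h := algebraMap_ne_zero_of_coeff (p := Polynomial.X ^ 4 - 1) (by
    simp [Polynomial.coeff_one])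
  simp only [map_sub, map_pow, map_one, RatFunc.algebraMap_X] at h
  have hr := qX_ne_zero
  rw [qsq, qX] at *
  contrapose! h
  field_simp at h
  linear_combination h

theorem qsq_add_inv_ne_zero : qsq + qsq⁻¹ ≠ 0 := by
  have h := algebraMap_ne_zero_of_coeff (p := Polynomial.X ^ 4 + 1) (by
    simp [Polynomial.coeff_one])
  simp only [map_add, map_pow, map_one, RatFunc.algebraMap_X] at h
  have hr := qX_ne_zero
  rw [qsq, qX] at *
  contrapose! h
  field_simp at h
  linear_combination h

theorem qsq_sub_one_add_inv_ne_zero : qsq - 1 + qsq⁻¹ ≠ 0 := by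
  have h := algebraMap_ne_zero_of_coeff (p := Polynomial.X ^ 4 - Polynomial.X ^ 2 + 1) (by
    simp [Polynomial.coeff_one, Polynomial.coeff_X_pow])
  simp only [map_add, map_sub, map_pow, map_one, RatFunc.algebraMap_X] at h
  have hr := qX_ne_zero
  rw [qsq, qX] at *
  contrapose! h
  field_simp at h
  linear_combination h

/-- Neighbouring letters. -/
def Adj {n : ℕ} (i j : Fin (n+2)) : Prop := (i : ℕ) + 1 = (j : ℕ) ∨ (j : ℕ) + 1 = (i : ℕ)

theorem Adj.symm {n : ℕ} {i j : Fin (n+2)} (h : Adj i j) : Adj j i := Or.symm h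

theorem Adj.ne {n : ℕ} {i j : Fin (n+2)} (h : Adj i j) : i ≠ j := by
  rintro rfl
  unfold Adj at h
  omega

theorem chi_even {n : ℕ} {c : Fin (n+2)} (h : (c : ℕ) ≠ n+1) : chi n c c = (qsq⁻¹) ^ 2 := by
  simp only [chi, pa, cart, h, if_false, if_true, qsq]
  rw [zpow_neg]
  norm_cast
  field_simp [qX_ne_zero]
  norm_num

theorem chi_odd {n : ℕ} {c : Fin (n+2)} (h : (c : ℕ) = n+1) : chi n c c = -qsq⁻¹ := by
  simp only [chi, pa, cart, h, if_true, qsq]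
  rw [zpow_neg]
  norm_cast
  norm_num

theorem chi_adj {n : ℕ} {i j : Fin (n+2)} (h : Adj i j) : chi n i j = qsq := by
  have h0 := h.ne
  have hp : pa n i * pa n j = 0 := by
    have : (i : ℕ) ≠ j := fun e => h0 (Fin.ext e)
    unfold pa
    split_ifs <;> simp_all
  rw [chi, hp, cart, if_neg h0, if_pos (show (i : ℕ) + 1 = j ∨ (j : ℕ) + 1 = i from h), qsq]
  norm_num

theorem chi_far {n : ℕ} {i j : Fin (n+2)} (h0 : i ≠ j) (h : ¬ Adj i j) : chi n i j = 1 := by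
  have hp : pa n i * pa n j = 0 := by
    have : (i : ℕ) ≠ j := fun e => h0 (Fin.ext e)
    unfold pa
    split_ifs <;> simp_all
  rw [chi, hp, cart, if_neg h0, if_neg (show ¬ ((i : ℕ) + 1 = j ∨ (j : ℕ) + 1 = i) from h)]
  norm_num

theorem Ualg_induction {n : ℕ} {f : F n →ₗ[Kq] F n} (h0 : f (wd n []) = 0)
    (h1 : ∀ j v, f v = 0 → f (lmul n j v) = 0) {u : F n} (hu : u ∈ Ualg n) : f u = 0 := by
  refine (Submodule.mem_bot Kq).1 (Ualg_le_comap (fun l => ?_) hu)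
  rw [Submodule.mem_bot]
  induction l with
  | nil => exact h0
  | cons i l ih => rw [prodLetters_cons]; exact h1 i _ ih

theorem del_serre_far {n : ℕ} {i j : Fin (n+2)} (h0 : i ≠ j) (h : ¬ Adj i j) {u : F n}
    (hu : u ∈ Ualg n) : del n i (del n j u) = del n j (del n i u) := by
  refine sub_eq_zero.1 (Ualg_induction (f := del n i ∘ₗ del n j - del n j ∘ₗ del n i)
    (by simp) (fun k v hv => ?_) hu)
  simp only [LinearMap.sub_apply, LinearMap.comp_apply] at hv ⊢
  have hv' := congrArg (lmul n k) hv
  have hx := chi_far h0 h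
  have hx' := chi_comm n i j ▸ hx
  simp only [map_sub, map_zero] at hv'
  simp only [del_lmul, map_add, map_smul]
  by_cases hi : i = k
  · subst hi
    simp only [if_true, h0.symm, if_false, map_zero, zero_add, hx]
    linear_combination (norm := skip) (chi n i i) • hv'
    match_scalars <;> field_simp <;> ring
  by_cases hj : j = k
  · subst hj
    simp only [if_true, hi, if_false, map_zero, zero_add, hx']
    linear_combination (norm := skip) (chi n j j) • hv'
    match_scalars <;> field_simp <;> ring
  simp only [hi, hj, if_false, map_zero, zero_add]
  linear_combination (norm := skip) (chi n k i * chi n k j) • hv'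
  match_scalars <;> field_simp <;> ring

theorem del_serre_quad {n : ℕ} {c d : Fin (n+2)} (hc : (c : ℕ) ≠ n+1) (h : Adj c d) {u : F n}
    (hu : u ∈ Ualg n) :
    del n c (del n c (del n d u)) - (qsq + qsq⁻¹) • del n c (del n d (del n c u))
      + del n d (del n c (del n c u)) = 0 := by
  refine Ualg_induction (f := del n c ∘ₗ del n c ∘ₗ del n d
    - (qsq + qsq⁻¹) • (del n c ∘ₗ del n d ∘ₗ del n c) + del n d ∘ₗ del n c ∘ₗ del n c)
    (by simp) (fun k v hv => ?_) hu
  simp only [LinearMap.add_apply, LinearMap.sub_apply, LinearMap.smul_apply,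
    LinearMap.comp_apply] at hv ⊢
  have hv' := congrArg (lmul n k) hv
  have hx := chi_adj h
  have hx' := chi_adj h.symm
  have hr := qsq_ne_zero
  simp only [map_sub, map_add, map_smul, map_zero] at hv'
  simp only [del_lmul, map_add, map_smul]
  by_cases hi : c = k
  · subst hi
    simp only [if_true, h.ne.symm, if_false, map_zero, zero_add, hx, chi_even hc]
    linear_combination (norm := skip) (qsq * (qsq⁻¹) ^ 4) • hv'
    match_scalars <;> field_simp <;> ring
  by_cases hj : d = k
  · subst hj
    simp only [if_true, hi, if_false, map_zero, zero_add, hx']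
    linear_combination (norm := skip) (qsq ^ 2 * chi n d d) • hv'
    match_scalars <;> field_simp <;> ring
  simp only [hi, hj, if_false, map_zero, zero_add]
  linear_combination (norm := skip) (chi n k c ^ 2 * chi n k d) • hv'
  match_scalars <;> field_simp <;> ring

theorem del_serre_cub {n : ℕ} {c d : Fin (n+2)} (hc : (c : ℕ) = n+1) (h : Adj c d) {u : F n}
    (hu : u ∈ Ualg n) :
    del n d (del n c (del n c (del n c u)))
      - (qsq - 1 + qsq⁻¹) • del n c (del n d (del n c (del n c u)))
      - (qsq - 1 + qsq⁻¹) • del n c (del n c (del n d (del n c u)))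
      + del n c (del n c (del n c (del n d u))) = 0 := by
  refine Ualg_induction (f := del n d ∘ₗ del n c ∘ₗ del n c ∘ₗ del n c
    - (qsq - 1 + qsq⁻¹) • (del n c ∘ₗ del n d ∘ₗ del n c ∘ₗ del n c)
    - (qsq - 1 + qsq⁻¹) • (del n c ∘ₗ del n c ∘ₗ del n d ∘ₗ del n c)
    + del n c ∘ₗ del n c ∘ₗ del n c ∘ₗ del n d)
    (by simp) (fun k v hv => ?_) hu
  simp only [LinearMap.add_apply, LinearMap.sub_apply, LinearMap.smul_apply,
    LinearMap.comp_apply] at hv ⊢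
  have hv' := congrArg (lmul n k) hv
  have hx := chi_adj h
  have hx' := chi_adj h.symm
  have hr := qsq_ne_zero
  simp only [map_sub, map_add, map_smul, map_zero] at hv'
  simp only [del_lmul, map_add, map_smul]
  by_cases hi : c = k
  · subst hi
    simp only [if_true, h.ne.symm, if_false, map_zero, zero_add, hx, chi_odd hc]
    linear_combination (norm := skip) (-qsq * (qsq⁻¹) ^ 3) • hv'
    match_scalars <;> field_simp <;> ring
  by_cases hj : d = k
  · subst hj
    simp only [if_true, hi, if_false, map_zero, zero_add, hx']
    linear_combination (norm := skip) (qsq ^ 3 * chi n d d) • hv'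
    match_scalars <;> field_simp <;> ring
  simp only [hi, hj, if_false, map_zero, zero_add]
  linear_combination (norm := skip) (chi n k c ^ 3 * chi n k d) • hv'
  match_scalars <;> field_simp <;> ring

/-- The word shuffles in the same way with `c` from the left and from the right. -/
def Central (n : ℕ) (c : Fin (n+2)) (s : List (Fin (n+2))) : Prop :=
  rmul n c (wd n s) = lmul n c (wd n s) ∧ tw n c s = 1

theorem rmul_snoc (n : ℕ) (c k : Fin (n+2)) (s : List (Fin (n+2))) :
    rmul n c (wd n (s ++ [k])) = app n k (rmul n c (wd n s))
      + (chi n k c * tw n c s) • wd n (s ++ [k] ++ [c]) := by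
  rw [← app_wd, rmul_app, twist_wd, map_smul, map_smul, smul_smul, app_wd, app_wd]

theorem lmul_snoc (n : ℕ) (c k : Fin (n+2)) (s : List (Fin (n+2))) :
    lmul n c (wd n (s ++ [k])) = wd n (s ++ [k] ++ [c])
      + chi n k c • app n k (lmul n c (wd n s)) := by
  rw [← app_wd, lmul_app, chi_comm, app_wd, app_wd]

theorem central_nil (n : ℕ) (c : Fin (n+2)) : Central n c [] := by simp [Central]

theorem Central.snoc {n : ℕ} {c k : Fin (n+2)} {s : List (Fin (n+2))} (hs : Central n c s)
    (h0 : k ≠ c) (h : ¬ Adj k c) : Central n c (s ++ [k]) := by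
  have hx := chi_far h0 h
  refine ⟨?_, by simp [hs.2, hx]⟩
  rw [rmul_snoc, lmul_snoc, hs.1, hs.2, hx]
  module

theorem Central.snoc_three {n : ℕ} {b c d : Fin (n+2)} {s : List (Fin (n+2))}
    (hs : Central n c s) (hc : (c : ℕ) ≠ n+1) (hb : Adj b c) (hd : Adj d c) :
    Central n c (s ++ [b] ++ [c] ++ [d]) := by
  have hr := qsq_ne_zero
  have hb := chi_adj hb
  have hd := chi_adj hd
  refine ⟨?_, ?_⟩
  · simp only [rmul_snoc, lmul_snoc, tw_append, hs.1, hs.2, hb, hd, chi_even hc, tw_cons, tw_nil,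
      map_add, map_smul, app_wd]
    match_scalars <;> field_simp
  · simp only [tw_append, hs.2, hb, hd, chi_even hc, tw_cons, tw_nil]
    field_simp

theorem Central.mem_snoc {n : ℕ} {c k : Fin (n+2)} {s : List (Fin (n+2))} (hs : Central n c s)
    (h : Adj k c) (hU : wd n (s ++ [k]) ∈ Ualg n) : wd n (s ++ [k] ++ [c]) ∈ Ualg n := by
  have hr := qsq_ne_zero
  have key : rmul n c (wd n (s ++ [k])) - qsq⁻¹ • lmul n c (wd n (s ++ [k]))
      = (qsq - qsq⁻¹) • wd n (s ++ [k] ++ [c]) := by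
    rw [rmul_snoc, lmul_snoc, hs.1, hs.2, chi_adj h]
    match_scalars <;> field_simp
    ring
  have := sub_mem (rmul_mem c hU) (Submodule.smul_mem _ qsq⁻¹ (lmul_mem c hU))
  rwa [key, Submodule.smul_mem_iff _ qsq_sub_inv_ne_zero] at this

theorem Central.mem_snoc_odd {n : ℕ} {b c : Fin (n+2)} {s : List (Fin (n+2))}
    (hs : Central n c s) (hc : (c : ℕ) = n+1) (h : Adj b c)
    (hU : wd n (s ++ [b] ++ [c]) ∈ Ualg n) : wd n (s ++ [b] ++ [c] ++ [c]) ∈ Ualg n := by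
  have hr := qsq_ne_zero
  have key : rmul n c (wd n (s ++ [b] ++ [c])) + lmul n c (wd n (s ++ [b] ++ [c]))
      = (qsq - qsq⁻¹) • wd n (s ++ [b] ++ [c] ++ [c]) := by
    simp only [rmul_snoc, lmul_snoc, tw_append, hs.1, hs.2, chi_adj h, chi_odd hc, tw_cons, tw_nil,
      map_add, map_smul, app_wd]
    match_scalars <;> field_simp <;> ring
  have := add_mem (rmul_mem c hU) (lmul_mem c hU)
  rwa [key, Submodule.smul_mem_iff _ qsq_sub_inv_ne_zero] at this

/-- The sequence of letters `0, 1, …, n+1, n+1, …, 1, 0`. -/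
def ell (n t : ℕ) : Fin (n+2) := ⟨min t (2*n+3-t), by omega⟩

theorem ell_val (n t : ℕ) : (ell n t : ℕ) = min t (2*n+3-t) := rfl

theorem adj_ell {n s t : ℕ} : Adj (ell n s) (ell n t) ↔
    min s (2*n+3-s) + 1 = min t (2*n+3-t) ∨ min t (2*n+3-t) + 1 = min s (2*n+3-s) := Iff.rfl

theorem ell_inj {n s t : ℕ} :
    ell n s = ell n t ↔ min s (2*n+3-s) = min t (2*n+3-t) := Fin.ext_iff

/-- The word with letters `ell n a, …, ell n (a+k-1)`. -/
def chain (n a : ℕ) : ℕ → List (Fin (n+2))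
  | 0 => []
  | k+1 => chain n a k ++ [ell n (a+k)]

theorem chain_succ (n a k : ℕ) : chain n a (k+1) = chain n a k ++ [ell n (a+k)] := rfl

theorem central_chain {n a t : ℕ} (ht : t ≤ n+1) {k : ℕ} (hk : a + k + 1 ≤ t) :
    Central n (ell n t) (chain n a k) := by
  induction k with
  | zero => exact central_nil _ _
  | succ k ih =>
    refine (ih (by omega)).snoc ?_ ?_
    · rw [Ne, ell_inj]; omega
    · rw [adj_ell]; omega

theorem central_chain_of_le {n a c : ℕ} (hc : c < n+1) (hac : a < c) {k : ℕ} (hk : c + 2 ≤ a + k)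
    (hk' : a + k + c ≤ 2*n+2) : Central n (ell n c) (chain n a k) := by
  induction k with
  | zero => omega
  | succ k ih =>
    by_cases h : c + 2 ≤ a + k
    · refine (ih h (by omega)).snoc ?_ ?_
      · rw [Ne, ell_inj]; omega
      · rw [adj_ell]; omega
    · obtain ⟨j, rfl⟩ : ∃ j, c = a + j + 1 := ⟨c - a - 1, by omega⟩
      obtain rfl : k = j + 2 := by omega
      have h1 : Central n (ell n (a+j+1)) (chain n a j) := central_chain (by omega) le_rfl
      refine h1.snoc_three ?_ ?_ ?_
      · rw [ell_val]; omega
      · rw [adj_ell]; omega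
      · rw [adj_ell]; omega

theorem chain_mem {n a k : ℕ} (hk : 1 ≤ k) (hk' : 2*a + k ≤ 2*n+3) :
    wd n (chain n a k) ∈ Ualg n := by
  induction k, hk using Nat.le_induction with
  | base =>
    have := prodLetters_mem n [ell n a]
    rwa [prodLetters_cons, prodLetters_nil, lmul_nil] at this
  | succ k hk ih =>
    have hU := ih (by omega)
    obtain ⟨j, rfl⟩ : ∃ j, k = j + 1 := ⟨k - 1, by omega⟩
    by_cases h1 : a + (j + 1) ≤ n + 1
    · exact (central_chain h1 (by omega)).mem_snoc (by rw [adj_ell]; omega) hU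
    by_cases h2 : a + (j + 1) = n + 2
    · obtain ⟨i, rfl⟩ : ∃ i, j = i + 1 := ⟨j - 1, by omega⟩
      have e : ell n (a + (i + 1 + 1)) = ell n (a + (i + 1)) := by rw [ell_inj]; omega
      simp only [chain, e] at hU ⊢
      exact (central_chain (t := a + (i + 1)) (by omega) (by omega)).mem_snoc_odd
        (by rw [ell_val]; omega) (by rw [adj_ell]; omega) hU
    · have e : ell n (a + (j + 1)) = ell n (2*n+3 - (a + (j + 1))) := by rw [ell_inj]; omega
      simp only [chain] at hU ⊢
      rw [e]
      exact (central_chain_of_le (by omega) (by omega) (by omega) (by omega)).mem_snoc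
        (by rw [adj_ell]; omega) hU

/-- The quantum Serre relations for a family of elements of an algebra. -/
structure SerreRel (n : ℕ) {A : Type*} [Ring A] [Algebra Kq A] (X : Fin (n+2) → A) : Prop where
  far : ∀ i j : Fin (n+2), i ≠ j → ¬ Adj i j → X i * X j = X j * X i
  quad : ∀ c d : Fin (n+2), (c : ℕ) ≠ n+1 → Adj c d →
    X c * X c * X d - (qsq + qsq⁻¹) • (X c * X d * X c) + X d * X c * X c = 0
  cub : ∀ c d : Fin (n+2), (c : ℕ) = n+1 → Adj c d →
    X d * X c * X c * X c - (qsq - 1 + qsq⁻¹) • (X c * X d * X c * X c)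
      - (qsq - 1 + qsq⁻¹) • (X c * X c * X d * X c) + X c * X c * X c * X d = 0

/-- Iterated braided commutators, starting from the letter `a`; the list of the other letters is
reversed. -/
noncomputable def iterAd (n : ℕ) {A : Type*} [Ring A] [Algebra Kq A] (X : Fin (n+2) → A)
    (a : Fin (n+2)) : List (Fin (n+2)) → A
  | [] => X a
  | c :: p => iterAd n X a p * X c - (chi n a c * tw n c p) • (X c * iterAd n X a p)

section
variable {n : ℕ} {A : Type*} [Ring A] [Algebra Kq A] {X : Fin (n+2) → A}

theorem iterAd_cons_eq_zero {a c : Fin (n+2)} {p : List (Fin (n+2))} (h : iterAd n X a p = 0) :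
    iterAd n X a (c :: p) = 0 := by simp [iterAd, h]

theorem SerreRel.iterAd_far (hX : SerreRel n X) (a : Fin (n+2)) {c d : Fin (n+2)} (h0 : c ≠ d)
    (h : ¬ Adj c d) (p : List (Fin (n+2))) :
    iterAd n X a (c :: d :: p) = iterAd n X a (d :: c :: p) := by
  have h1 := congrArg (iterAd n X a p * ·) (hX.far c d h0 h)
  have h2 := congrArg (· * iterAd n X a p) (hX.far c d h0 h)
  have hx := chi_far h0 h
  have hx' := chi_comm n c d ▸ hx
  simp only [iterAd, tw_cons, hx, hx', mul_sub, sub_mul, smul_mul_assoc, mul_smul_comm,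
    mul_assoc] at h1 h2 ⊢
  linear_combination (norm := skip)
    -h1 + ((chi n a c * tw n c p) * (chi n a d * tw n d p)) • h2
  match_scalars <;> ring

theorem SerreRel.iterAd_quad (hX : SerreRel n X) (a : Fin (n+2)) {c d : Fin (n+2)}
    (hc : (c : ℕ) ≠ n+1) (h : Adj c d) (p : List (Fin (n+2))) :
    iterAd n X a (c :: c :: d :: p) - (qsq + qsq⁻¹) • iterAd n X a (c :: d :: c :: p)
      + iterAd n X a (d :: c :: c :: p) = 0 := by
  have h1 := congrArg (iterAd n X a p * ·) (hX.quad c d hc h)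
  have h2 := congrArg (· * iterAd n X a p) (hX.quad c d hc h)
  have hr := qsq_ne_zero
  simp only [iterAd, tw_cons, chi_adj h, chi_adj h.symm, chi_even hc, mul_add, mul_sub, add_mul,
    sub_mul, smul_mul_assoc, mul_smul_comm, mul_assoc, mul_zero, zero_mul] at h1 h2 ⊢
  linear_combination (norm := skip)
    h1 - ((chi n a c * tw n c p) ^ 2 * (chi n a d * tw n d p)) • h2
  match_scalars <;> field_simp <;> ring

theorem SerreRel.iterAd_cub (hX : SerreRel n X) (a : Fin (n+2)) {c d : Fin (n+2)}
    (hc : (c : ℕ) = n+1) (h : Adj c d) (p : List (Fin (n+2))) :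
    iterAd n X a (d :: c :: c :: c :: p)
      - (qsq - 1 + qsq⁻¹) • iterAd n X a (c :: d :: c :: c :: p)
      - (qsq - 1 + qsq⁻¹) • iterAd n X a (c :: c :: d :: c :: p)
      + iterAd n X a (c :: c :: c :: d :: p) = 0 := by
  have h1 := congrArg (iterAd n X a p * ·) (hX.cub c d hc h)
  have h2 := congrArg (· * iterAd n X a p) (hX.cub c d hc h)
  have hr := qsq_ne_zero
  simp only [iterAd, tw_cons, chi_adj h, chi_adj h.symm, chi_odd hc, mul_add, mul_sub, add_mul,
    sub_mul, smul_mul_assoc, mul_smul_comm, mul_assoc, mul_zero, zero_mul] at h1 h2 ⊢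
  linear_combination (norm := skip)
    h1 - ((chi n a c * tw n c p) ^ 3 * (chi n a d * tw n d p)) • h2
  match_scalars <;> field_simp <;> ring

theorem commute_step {x₀ x₁ x₂ c d : A} {m₁ m₂ m₄ m₅ v : Kq} (h₁ : x₁ = x₀ * c - m₁ • (c * x₀))
    (h₂ : x₂ = x₁ * d - m₄ • (d * x₁)) (h0d : x₀ * d = m₂ • (d * x₀))
    (h2c : x₂ * c = m₅ • (c * x₂)) (h01 : x₀ * x₁ = v • (x₁ * x₀)) (hm : m₅ ≠ 0) :
    x₁ * x₂ = (v * m₂ * m₅⁻¹) • (x₂ * x₁) := by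
  have hA : x₀ * x₂ = (v * m₂) • (x₂ * x₀) := by
    have e1 := congrArg (· * d) h01
    have e2 := congrArg (x₁ * ·) h0d
    have e3 := congrArg (· * x₁) h0d
    have e4 := congrArg (d * ·) h01
    clear h₁ h2c h01 h0d
    subst h₂
    simp only [mul_sub, sub_mul, smul_mul_assoc, mul_smul_comm, mul_assoc] at e1 e2 e3 e4 ⊢
    linear_combination (norm := module) e1 + v • e2 - m₄ • e3 - (m₄ * m₂) • e4
  have e1 := congrArg (x₀ * ·) h2c
  have e2 := congrArg (· * c) hA
  have e3 := congrArg (c * ·) hA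
  have e4 := congrArg (· * x₀) h2c
  clear h₂ h2c hA h01 h0d
  subst h₁
  simp only [mul_sub, sub_mul, smul_mul_assoc, mul_smul_comm, mul_assoc] at e1 e2 e3 e4 ⊢
  linear_combination (norm := skip) m₅⁻¹ • e2 - m₅⁻¹ • e1 - m₁ • e3 + (v * m₂ * m₅⁻¹ * m₁) • e4
  match_scalars <;> field_simp <;> ring

theorem commute_middle {x₀ x₁ x₂ c : A} {m m' l v : Kq} (h₁ : x₁ = x₀ * c - m' • (c * x₀))
    (h₂ : x₂ = x₁ * c - m • (c * x₁)) (h2c : x₂ * c = l • (c * x₂))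
    (h01 : x₀ * x₁ = v • (x₁ * x₀)) (hm : m ^ 2 = l * m') (hl : l - v + m ≠ 0) :
    ∃ k : Kq, x₁ * x₂ = k • (x₂ * x₁) := by
  have h0c : x₀ * c = x₁ + m' • (c * x₀) := by rw [h₁]; abel
  have h1c : x₁ * c = x₂ + m • (c * x₁) := by rw [h₂]; abel
  clear h₁ h₂
  have hB : x₀ * x₂ = (v * m') • (x₂ * x₀) + (v - m) • (x₁ * x₁) := by
    have e1 := congrArg (· * c) h01
    have e2 := congrArg (x₁ * ·) h0c
    have e3 := congrArg (x₀ * ·) h1c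
    have e4 := congrArg (· * x₁) h0c
    have e5 := congrArg (· * x₀) h1c
    have e6 := congrArg (c * ·) h01
    simp only [mul_add, add_mul, smul_mul_assoc, mul_smul_comm, mul_assoc] at e1 e2 e3 e4 e5 e6 ⊢
    linear_combination (norm := module)
      e1 - e3 + v • e2 - m • e4 + (v * m') • e5 - (m * m') • e6
  refine ⟨(l - v + m)⁻¹ * (v * m' + (v - m) * m), ?_⟩
  rw [← smul_smul, eq_inv_smul_iff₀ hl]
  have e1 := congrArg (· * c) hB
  have e2 := congrArg (x₀ * ·) h2c
  have e3 := congrArg (· * x₂) h0c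
  have e4 := congrArg (x₂ * ·) h0c
  have e5 := congrArg (· * x₀) h2c
  have e6 := congrArg (x₁ * ·) h1c
  have e7 := congrArg (· * x₁) h1c
  have e8 := congrArg (c * ·) hB
  simp only [mul_add, add_mul, smul_mul_assoc, mul_smul_comm, mul_assoc] at e1 e2 e3 e4 e5 e6 e7 e8 ⊢
  linear_combination (norm := skip) e1 - e2 - l • e3 + (v * m') • e4 + (v * m' * m') • e5
      + (v - m) • e6 + ((v - m) * m) • e7 - (l * m') • e8
  match_scalars <;> first | ring1 | linear_combination (v - m) * hm

/-- The letters `ell n (a+1), …, ell n (a+k)`, in reversed order. -/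
def revTail (n a : ℕ) : ℕ → List (Fin (n+2))
  | 0 => []
  | k+1 => ell n (a+k+1) :: revTail n a k

theorem chain_succ_eq (n a k : ℕ) : chain n a (k+1) = ell n a :: (revTail n a k).reverse := by
  induction k with
  | zero => rfl
  | succ k ih => rw [chain, ih, revTail, List.reverse_cons, List.cons_append, add_assoc]

theorem tw_revTail (n a k : ℕ) (c : Fin (n+2)) :
    chi n (ell n a) c * tw n c (revTail n a k) = tw n c (chain n a (k+1)) := by
  rw [chain_succ_eq, tw_cons, tw_reverse, chi_comm]

theorem chi_ne_zero (n : ℕ) (i j : Fin (n+2)) : chi n i j ≠ 0 :=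
  mul_ne_zero (pow_ne_zero _ (by norm_num)) (zpow_ne_zero _ qX_ne_zero)

theorem tw_ne_zero (n : ℕ) (c : Fin (n+2)) (w : List (Fin (n+2))) : tw n c w ≠ 0 := by
  induction w with
  | nil => simp
  | cons i w ih => rw [tw_cons]; exact mul_ne_zero (chi_ne_zero _ _ _) ih

/-- The iterated braided commutator along the word `chain n a (k+1)`. -/
noncomputable def chainAd (n : ℕ) (X : Fin (n+2) → A) (a k : ℕ) : A :=
  iterAd n X (ell n a) (revTail n a k)

theorem iterAd_revTail (X : Fin (n+2) → A) (a k : ℕ) (c : Fin (n+2)) :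
    iterAd n X (ell n a) (c :: revTail n a k)
      = chainAd n X a k * X c - tw n c (chain n a (k+1)) • (X c * chainAd n X a k) := by
  rw [iterAd, tw_revTail, chainAd]

theorem chainAd_succ (X : Fin (n+2) → A) (a k : ℕ) :
    chainAd n X a (k+1) = chainAd n X a k * X (ell n (a+k+1))
      - tw n (ell n (a+k+1)) (chain n a (k+1)) • (X (ell n (a+k+1)) * chainAd n X a k) :=
  iterAd_revTail X a k _

theorem SerreRel.iterAd_revTail_eq_zero (hX : SerreRel n X) {a c : ℕ} (hac : a < c)
    (hc : c ≤ n+1) (k : ℕ) (hk : 2*a + k ≤ 2*n+2) (hne : ell n c ≠ ell n (a+k+1)) :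
    iterAd n X (ell n a) (ell n c :: revTail n a k) = 0 := by
  induction k using Nat.strong_induction_on generalizing c with | _ k ih => ?_
  have hr := qsq_ne_zero
  rw [Ne, ell_inj] at hne
  rcases k with _ | k
  · have h1 : ell n a ≠ ell n c := by rw [Ne, ell_inj]; omega
    have h2 : ¬ Adj (ell n a) (ell n c) := by rw [adj_ell]; omega
    simp [revTail, iterAd, hX.far _ _ h1 h2, chi_far h1 h2]
  by_cases hfar : ell n c ≠ ell n (a+k+1) ∧ ¬ Adj (ell n c) (ell n (a+k+1))
  · rw [revTail, hX.iterAd_far _ hfar.1 hfar.2]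
    exact iterAd_cons_eq_zero (ih k (by omega) hac hc (by omega) hfar.1)
  rw [Ne, ell_inj, adj_ell] at hfar
  by_cases hasc : a+k+1 ≤ n+1
  · rcases k with _ | k
    · obtain rfl : c = a+1 := by omega
      have had : Adj (ell n (a+1)) (ell n a) := by rw [adj_ell]; omega
      have hv : (ell n (a+1) : ℕ) ≠ n+1 := by rw [ell_val]; omega
      have h1 := hX.quad _ _ hv had
      simp only [revTail, iterAd, tw_cons, tw_nil, chi_adj had.symm, chi_even hv, mul_sub, sub_mul,
        smul_mul_assoc, mul_smul_comm, mul_assoc, add_zero] at h1 ⊢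
      linear_combination (norm := skip) h1
      match_scalars <;> field_simp <;> ring
    have had : Adj (ell n (a+k+1+1)) (ell n (a+k+1)) := by rw [adj_ell]; omega
    by_cases hct : c = a+k+1+1
    · subst hct
      have h1 := hX.iterAd_quad (ell n a) (by rw [ell_val]; omega) had (revTail n a k)
      have h2 := ih k (by omega) hac hc (by omega) (by rw [Ne, ell_inj]; omega)
      simpa [revTail, iterAd_cons_eq_zero, h2, ← add_assoc] using h1
    · obtain rfl : c = a+k+1 := by omega
      have h1 := hX.iterAd_quad (ell n a) (by rw [ell_val]; omega) had.symm (revTail n a k)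
      have h2 := ih k (by omega) (c := a+k+1+1) (by omega) (by omega) (by omega)
        (by rw [Ne, ell_inj]; omega)
      have h3 := ih (k+1) (by omega) hac hc (by omega) (by rw [Ne, ell_inj]; omega)
      rw [revTail] at h3
      simpa [revTail, iterAd_cons_eq_zero, h2, h3, qsq_add_inv_ne_zero, ← add_assoc] using h1
  obtain ⟨k, rfl⟩ : ∃ k', k = k'+1 := ⟨k-1, by omega⟩
  by_cases hmid : a+(k+1)+1 = n+2
  · obtain rfl : c = n+1 := by omega
    have e1 : ell n (a+(k+1)+1) = ell n (n+1) := by rw [ell_inj]; omega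
    have e2 : ell n (a+k+1) = ell n (n+1) := by rw [ell_inj]; omega
    have hv : (ell n (n+1) : ℕ) = n+1 := by rw [ell_val]; omega
    rw [revTail, revTail, e1, e2]
    rcases k with _ | k
    · have had : Adj (ell n (n+1)) (ell n a) := by rw [adj_ell]; omega
      have h1 := hX.cub _ _ hv had
      simp only [revTail, iterAd, tw_cons, tw_nil, chi_adj had.symm, chi_odd hv, mul_sub, sub_mul,
        smul_mul_assoc, mul_smul_comm, mul_assoc] at h1 ⊢
      linear_combination (norm := skip) h1
      match_scalars <;> field_simp <;> ring
    · have had : Adj (ell n (n+1)) (ell n (a+k+1)) := by rw [adj_ell]; omega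
      have h1 := hX.iterAd_cub (ell n a) hv had (revTail n a k)
      have h2 := ih k (by omega) hac hc (by omega) (by rw [Ne, ell_inj]; omega)
      have h2' := fun i => iterAd_cons_eq_zero (c := i) h2
      simpa [revTail, iterAd_cons_eq_zero, h2, h2'] using h1
  have had : Adj (ell n (a+(k+1)+1)) (ell n (a+k+1)) := by rw [adj_ell]; omega
  obtain ⟨j, hj⟩ : ∃ j, j = 2*n+3-(a+(k+1)+1) := ⟨_, rfl⟩
  have ej : ell n (a+(k+1)+1) = ell n j := by rw [ell_inj]; omega
  rw [ej] at had
  have h2 := ih k (by omega) (c := j) (by omega) (by omega) (by omega) (by rw [Ne, ell_inj]; omega)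
  by_cases hcj : c = j
  · subst hcj
    have h1 := hX.iterAd_quad (ell n a) (by rw [ell_val]; omega) had (revTail n a k)
    simpa [revTail, ej, iterAd_cons_eq_zero, h2] using h1
  obtain rfl : c = j+1 := by omega
  have ec : ell n (a+k+1) = ell n (j+1) := by rw [ell_inj]; omega
  rw [ec] at had
  have h3 := ih (k+1) (by omega) hac hc (by omega) (by rw [Ne, ell_inj]; omega)
  by_cases hcn : j+1 = n+1
  · obtain ⟨k, rfl⟩ : ∃ k', k = k'+1 := ⟨k-1, by omega⟩
    have e : ell n (a+k+1) = ell n (j+1) := by rw [ell_inj]; omega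
    have h1 := hX.iterAd_cub (ell n a) (by rw [ell_val]; omega) had.symm (revTail n a k)
    have h4 := ih k (by omega) (c := j) (by omega) (by omega) (by omega)
      (by rw [Ne, ell_inj]; omega)
    rw [revTail, ec, revTail, e] at h3
    rw [revTail, e] at h2
    rw [revTail, revTail, revTail, e, ec, ej]
    have h4' := fun i => iterAd_cons_eq_zero (c := i) h4
    simpa [iterAd_cons_eq_zero, h2, h3, h4, h4', qsq_sub_one_add_inv_ne_zero] using h1
  · have h1 := hX.iterAd_quad (ell n a) (by rw [ell_val]; omega) had.symm (revTail n a k)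
    rw [revTail, ec] at h3
    rw [revTail, revTail, ec, ej]
    simpa [iterAd_cons_eq_zero, h2, h3, qsq_add_inv_ne_zero] using h1

theorem SerreRel.chainAd_mul (hX : SerreRel n X) {a c k : ℕ} (hac : a < c) (hc : c ≤ n+1)
    (hk : 2*a + k ≤ 2*n+2) (hne : ell n c ≠ ell n (a+k+1)) :
    chainAd n X a k * X (ell n c)
      = tw n (ell n c) (chain n a (k+1)) • (X (ell n c) * chainAd n X a k) := by
  rw [← sub_eq_zero, ← iterAd_revTail]
  exact hX.iterAd_revTail_eq_zero hac hc k hk hne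

theorem tw_chain_succ (n a k : ℕ) (c : Fin (n+2)) :
    tw n c (chain n a (k+1)) = tw n c (chain n a k) * chi n (ell n (a+k)) c := by
  simp [chain, tw_append, chi_comm]

theorem tw_chain_next {a k : ℕ} (hk : a + k + 1 ≤ n+1) :
    tw n (ell n (a+k+1)) (chain n a (k+1)) = qsq := by
  rw [tw_chain_succ, (central_chain hk le_rfl).2, chi_adj (by rw [adj_ell]; omega), one_mul]

theorem SerreRel.chainAd_mul_succ (hX : SerreRel n X) {a k : ℕ} (hk : 2*a + k + 1 ≤ 2*n+2) :
    ∃ v : Kq, chainAd n X a k * chainAd n X a (k+1) = v • (chainAd n X a (k+1) * chainAd n X a k)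
      ∧ (a + k + 1 ≤ n+1 → v = qsq⁻¹) := by
  have hr := qsq_ne_zero
  induction k with
  | zero =>
    refine ⟨qsq⁻¹, ?_, fun _ => rfl⟩
    have had : Adj (ell n a) (ell n (a+1)) := by rw [adj_ell]; omega
    have h1 := hX.quad _ _ (by rw [ell_val]; omega) had
    simp only [chainAd, revTail, iterAd, tw_nil, chi_adj had, mul_sub, sub_mul,
      smul_mul_assoc, mul_smul_comm, mul_assoc, add_zero] at h1 ⊢
    linear_combination (norm := skip) h1
    match_scalars <;> field_simp <;> ring
  | succ k ih =>
    obtain ⟨v, hv, hv'⟩ := ih (by omega)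
    obtain ⟨c, hc⟩ : ∃ c, c = min (a+k+1) (2*n+3-(a+k+1)) := ⟨_, rfl⟩
    obtain ⟨d, hd⟩ : ∃ d, d = min (a+k+2) (2*n+3-(a+k+2)) := ⟨_, rfl⟩
    have ec : ell n (a+k+1) = ell n c := by rw [ell_inj]; omega
    have ed : ell n (a+(k+1)+1) = ell n d := by rw [ell_inj]; omega
    have hX1 := chainAd_succ X a k
    have hX2 := chainAd_succ X a (k+1)
    have h2c := hX.chainAd_mul (a := a) (c := c) (k := k+1+1) (by omega) (by omega) (by omega)
      (by rw [Ne, ell_inj]; omega)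
    rw [ec] at hX1
    rw [ed] at hX2
    by_cases hcd : c = d
    · have hN : c = n+1 := by omega
      have hk : a+k+1 = n+1 := by omega
      rw [← hcd] at hX2
      have t1 : tw n (ell n c) (chain n a (k+1)) = qsq := by
        rw [← ec]; exact tw_chain_next (by omega)
      have t2 : tw n (ell n c) (chain n a (k+1+1)) = -1 := by
        rw [tw_chain_succ, t1, ← add_assoc, ec, chi_odd (by rw [ell_val]; omega)]
        field_simp
      have t3 : tw n (ell n c) (chain n a (k+1+1+1)) = qsq⁻¹ := by
        rw [tw_chain_succ, t2,
          show ell n (a+(k+1+1)) = ell n c from ed.trans (by rw [hcd]), chi_odd (by rw [ell_val]; omega)]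
        ring
      rw [t1] at hX1
      rw [t2] at hX2
      rw [t3] at h2c
      rw [hv' (by omega)] at hv
      obtain ⟨κ, hκ⟩ := commute_middle hX1 hX2 h2c hv (by field_simp) (by norm_num)
      exact ⟨κ, hκ, by omega⟩
    · have h0d := hX.chainAd_mul (a := a) (c := d) (k := k) (by omega) (by omega) (by omega)
        (by rw [Ne, ell_inj]; omega)
      refine ⟨_, commute_step hX1 hX2 h0d h2c hv (tw_ne_zero _ _ _), fun h => ?_⟩
      rw [hv' (by omega), (central_chain (by omega) (by omega)).2,
        (central_chain_of_le (by omega) (by omega) (by omega) (by omega)).2]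
      simp

/-- The product of the elements attached to the letters of a word. -/
def word {M : Type*} [Monoid M] (X : Fin (n+2) → M) (w : List (Fin (n+2))) : M := (w.map X).prod

theorem word_append {M : Type*} [Monoid M] (X : Fin (n+2) → M) (v w : List (Fin (n+2))) :
    word X (v ++ w) = word X v * word X w := by simp [word]

theorem word_singleton {M : Type*} [Monoid M] (X : Fin (n+2) → M) (c : Fin (n+2)) :
    word X [c] = X c := by simp [word]

/-- The span of the products along words with a prefix in `S`. -/
noncomputable def prefSpan (X : Fin (n+2) → A) (S : Set (List (Fin (n+2)))) : Submodule Kq A :=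
  Submodule.span Kq {x | ∃ w, (∃ p ∈ S, p <+: w) ∧ word X w = x}

theorem word_mem_prefSpan (X : Fin (n+2) → A) {S : Set (List (Fin (n+2)))}
    {p w : List (Fin (n+2))} (hp : p ∈ S) (h : p <+: w) : word X w ∈ prefSpan X S :=
  Submodule.subset_span ⟨w, ⟨p, hp, h⟩, rfl⟩

theorem prefSpan_mono (X : Fin (n+2) → A) {S T : Set (List (Fin (n+2)))} (h : S ⊆ T) :
    prefSpan X S ≤ prefSpan X T := by
  refine Submodule.span_mono ?_
  rintro x ⟨w, ⟨p, hp, hw⟩, rfl⟩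
  exact ⟨w, ⟨p, h hp, hw⟩, rfl⟩

theorem mul_mem_prefSpan {X : Fin (n+2) → A} {S : Set (List (Fin (n+2)))} {x y : A}
    (hx : x ∈ prefSpan X S) (hy : y ∈ prefSpan X {[]}) : x * y ∈ prefSpan X S := by
  have := Submodule.mul_mem_mul hx hy
  rw [prefSpan, prefSpan, Submodule.span_mul_span] at this
  refine Submodule.span_mono ?_ this
  rintro _ ⟨_, ⟨v, ⟨p, hp, hv⟩, rfl⟩, _, ⟨w, -, rfl⟩, rfl⟩
  exact ⟨v ++ w, ⟨p, hp, hv.trans (List.prefix_append v w)⟩, word_append X v w⟩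

theorem word_mem_prefSpan_nil (X : Fin (n+2) → A) (w : List (Fin (n+2))) :
    word X w ∈ prefSpan X {[]} := word_mem_prefSpan X rfl (List.nil_prefix)

theorem letter_mem_prefSpan_nil (X : Fin (n+2) → A) (c : Fin (n+2)) : X c ∈ prefSpan X {[]} := by
  rw [← word_singleton X]
  exact word_mem_prefSpan_nil X _

theorem chainAd_mem_prefSpan_nil (X : Fin (n+2) → A) (a k : ℕ) :
    chainAd n X a k ∈ prefSpan X {[]} := by
  induction k with
  | zero => exact letter_mem_prefSpan_nil X _
  | succ k ih =>
    rw [chainAd_succ]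
    exact sub_mem (mul_mem_prefSpan ih (letter_mem_prefSpan_nil X _))
      (Submodule.smul_mem _ _ (mul_mem_prefSpan (letter_mem_prefSpan_nil X _) ih))

/-- The one-letter words with a letter larger than `a`. -/
def above (n a : ℕ) : Set (List (Fin (n+2))) := {p | ∃ b : Fin (n+2), a < (b : ℕ) ∧ p = [b]}

theorem letter_mem_prefSpan_above (X : Fin (n+2) → A) {a : ℕ} {b : Fin (n+2)} (h : a < (b : ℕ)) :
    X b ∈ prefSpan X (above n a) := by
  rw [← word_singleton X]
  exact word_mem_prefSpan X ⟨b, h, rfl⟩ (List.prefix_refl _)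

theorem chainAd_sub_mem (X : Fin (n+2) → A) {a k : ℕ} (hk : 2*a + k ≤ 2*n+2) :
    chainAd n X a k - word X (chain n a (k+1)) ∈ prefSpan X (above n a) := by
  induction k with
  | zero => simp [chainAd, revTail, iterAd, chain, word]
  | succ k ih =>
    have h1 : (chainAd n X a k - word X (chain n a (k+1))) * X (ell n (a+k+1))
        ∈ prefSpan X (above n a) :=
      mul_mem_prefSpan (ih (by omega)) (letter_mem_prefSpan_nil X _)
    have h2 : X (ell n (a+k+1)) * chainAd n X a k ∈ prefSpan X (above n a) :=
      mul_mem_prefSpan (letter_mem_prefSpan_above X (by rw [ell_val]; omega))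
        (chainAd_mem_prefSpan_nil X a k)
    convert sub_mem h1 (Submodule.smul_mem _
      (tw n (ell n (a+k+1)) (chain n a (k+1))) h2) using 1
    rw [chainAd_succ, chain_succ n a (k+1), word_append, word_singleton, sub_mul]
    rw [sub_right_comm, add_assoc a k 1]

theorem SerreRel.word_chain_snoc_mem (hX : SerreRel n X) {a c k : ℕ} (hac : a < c) (hc : c ≤ n+1)
    (hk : 2*a + k ≤ 2*n+2) (hne : ell n c ≠ ell n (a+k+1)) :
    word X (chain n a (k+1) ++ [ell n c]) ∈ prefSpan X (above n a) := by
  have h1 := mul_mem_prefSpan (chainAd_sub_mem X hk) (letter_mem_prefSpan_nil X (ell n c))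
  have h2 : X (ell n c) * chainAd n X a k ∈ prefSpan X (above n a) :=
    mul_mem_prefSpan (letter_mem_prefSpan_above X (by rw [ell_val]; omega))
      (chainAd_mem_prefSpan_nil X a k)
  have h3 := sub_mem (Submodule.smul_mem _ (tw n (ell n c) (chain n a (k+1))) h2) h1
  rwa [← hX.chainAd_mul hac hc hk hne, sub_mul, sub_sub_cancel, ← word_singleton X,
    ← word_append] at h3

theorem ell_surj (b : Fin (n+2)) : ell n b = b := by
  apply Fin.ext
  rw [ell_val]
  omega

theorem SerreRel.word_chain_append_chain_mem (hX : SerreRel n X) {a k : ℕ}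
    (hk : 2*a + k + 1 ≤ 2*n+2) :
    word X (chain n a (k+1) ++ chain n a (k+2))
      ∈ prefSpan X (above n a ∪ {chain n a (k+2)}) := by
  have hle := prefSpan_mono X (Set.subset_union_left (s := above n a) (t := {chain n a (k+2)}))
  have hV := chainAd_mem_prefSpan_nil X a k
  have hsub := chainAd_sub_mem X (a := a) (k := k) (by omega)
  have hsub' := chainAd_sub_mem X (a := a) (k := k+1) (by omega)
  have hV' : chainAd n X a (k+1) ∈ prefSpan X (above n a ∪ {chain n a (k+2)}) := by
    rw [← sub_add_cancel (chainAd n X a (k+1)) (word X (chain n a (k+2)))]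
    exact add_mem (hle hsub') (word_mem_prefSpan X (Or.inr rfl) (List.prefix_refl _))
  have hmul : ∀ i ∈ prefSpan X (above n a),
      chainAd n X a k * i ∈ prefSpan X (above n a ∪ {chain n a (k+2)}) := by
    intro i hi
    induction hi using Submodule.span_induction with
    | zero => simp
    | add x y _ _ hx hy => rw [mul_add]; exact add_mem hx hy
    | smul r x _ hx => rw [mul_smul_comm]; exact Submodule.smul_mem _ _ hx
    | mem x hx =>
      obtain ⟨_, ⟨_, ⟨b, hb, rfl⟩, ⟨w, rfl⟩⟩, rfl⟩ := hx
      rw [word_append, word_singleton, ← mul_assoc]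
      refine mul_mem_prefSpan ?_ (word_mem_prefSpan_nil X w)
      have hbV := hle (mul_mem_prefSpan (letter_mem_prefSpan_above X hb) hV)
      by_cases hbk : b = ell n (a+k+1)
      · have e := chainAd_succ X a k
        rw [← hbk, eq_sub_iff_add_eq] at e
        rw [← e]
        exact add_mem hV' (Submodule.smul_mem _ _ hbV)
      · have e := hX.chainAd_mul (a := a) (c := b) (k := k) hb (by omega) (by omega)
          (by rwa [ell_surj])
        rw [ell_surj] at e
        rw [e]
        exact Submodule.smul_mem _ _ hbV
  obtain ⟨v, hv, -⟩ := hX.chainAd_mul_succ hk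
  have h1 := Submodule.smul_mem _ v (mul_mem_prefSpan hV' hV)
  rw [← hv] at h1
  have h2 := hmul _ hsub'
  have h3 := hle (mul_mem_prefSpan hsub (word_mem_prefSpan_nil X (chain n a (k+2))))
  convert sub_mem (sub_mem h1 h2) h3 using 1
  rw [word_append]
  noncomm_ring

end

/-- Instance search does not find this ring structure. -/
noncomputable instance endRing (n : ℕ) : Ring (Module.End Kq (Ualg n)) :=
  @Module.End.instRing Kq (Ualg n) _ (Submodule.addCommGroup _) _

/-- The derivations acting on `U`. -/
noncomputable def delEnd (n : ℕ) (i : Fin (n+2)) : Module.End Kq (Ualg n) :=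
  (del n i).restrict fun _ hu => del_mem i hu

theorem serreRel_delEnd (n : ℕ) : SerreRel n (delEnd n) where
  far _ _ h0 h := LinearMap.ext fun u => Subtype.ext (del_serre_far h0 h u.2)
  quad _ _ hc h := LinearMap.ext fun u => Subtype.ext (del_serre_quad hc h u.2)
  cub _ _ hc h := LinearMap.ext fun u => Subtype.ext (del_serre_cub hc h u.2)

theorem word_delEnd_apply {n : ℕ} (w z : List (Fin (n+2))) (u : Ualg n) :
    (word (delEnd n) w u : F n) z = (u : F n) (z ++ w) := by
  induction w generalizing z with
  | nil => simp [word]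
  | cons c w ih =>
    rw [← List.singleton_append, word_append, word_singleton, Module.End.mul_apply]
    exact (ih (z ++ [c])).trans (by simp)

/-- The word `p` is larger than `w`, already at a position common to both words. -/
def ExceedsAt {n : ℕ} (p w : List (Fin (n+2))) : Prop :=
  ∃ (s : List (Fin (n+2))) (c d : Fin (n+2)) (p' w' : List (Fin (n+2))),
    d < c ∧ p = s ++ c :: p' ∧ w = s ++ d :: w'

theorem wlt_asymm {n : ℕ} {v w : List (Fin (n+2))} (h : wlt n v w) : ¬ wlt n w v := by
  intro h'
  rw [wlt, ← List.lt_iff_lex_lt] at h h'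
  exact lt_asymm (α := List (Fin (n+2))) h h'

theorem wlt_irrefl {n : ℕ} (v : List (Fin (n+2))) : ¬ wlt n v v := fun h => wlt_asymm h h

theorem ExceedsAt.wlt {n : ℕ} {p w : List (Fin (n+2))} (h : ExceedsAt p w)
    (z r y : List (Fin (n+2))) : wlt n (z ++ w ++ y) (z ++ (p ++ r)) := by
  obtain ⟨s, c, d, p', w', hdc, rfl, rfl⟩ := h
  simp only [List.append_assoc, List.cons_append]
  exact List.Lex.append_left _ (List.Lex.append_left _ (List.Lex.rel hdc) s) z

theorem IsMaxWord.word_notMem {n : ℕ} {u : F n} (hu : u ∈ Ualg n) {z w y : List (Fin (n+2))}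
    (h : IsMaxWord n u (z ++ w ++ y)) {S : Set (List (Fin (n+2)))} (hS : ∀ p ∈ S, ExceedsAt p w) :
    word (delEnd n) w ∉ prefSpan (delEnd n) S := by
  intro hw
  have key : ∀ v, (word (delEnd n) v (word (delEnd n) y ⟨u, hu⟩) : F n) z = u (z ++ v ++ y) :=
    fun v => by rw [word_delEnd_apply, word_delEnd_apply]
  have : ∀ x ∈ prefSpan (delEnd n) S, (x (word (delEnd n) y ⟨u, hu⟩) : F n) z = 0 := by
    intro x hx
    induction hx using Submodule.span_induction with
    | zero => simp
    | add x y _ _ hx hy => simp [hx, hy]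
    | smul r x _ hx => simp [hx]
    | mem x hx =>
      obtain ⟨_, ⟨p, hp, ⟨r, rfl⟩⟩, rfl⟩ := hx
      rw [key]
      by_contra h0
      have hlt := (hS p hp).wlt z (r ++ y) y
      rw [← List.append_assoc p, ← List.append_assoc z] at hlt
      rcases h.2 _ (Finsupp.mem_support_iff.2 h0) with e | e
      · rw [e] at hlt
        exact wlt_irrefl _ hlt
      · exact wlt_asymm hlt e
  exact Finsupp.mem_support_iff.1 h.1 ((key w).symm.trans (this _ hw))

theorem IsDominant.not_chain_snoc {n a c k : ℕ} (hac : a < c) (hc : c ≤ n+1)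
    (hk : 2*a + k ≤ 2*n+2) (hne : ell n c ≠ ell n (a+k+1)) {z y : List (Fin (n+2))} :
    ¬ IsDominant n (z ++ (chain n a (k+1) ++ [ell n c]) ++ y) := by
  rintro ⟨u, hu, h⟩
  refine h.word_notMem hu ?_ ((serreRel_delEnd n).word_chain_snoc_mem hac hc hk hne)
  rintro _ ⟨b, hb, rfl⟩
  refine ⟨[], b, ell n a, [], (revTail n a k).reverse ++ [ell n c], ?_, rfl, ?_⟩
  · rw [Fin.lt_def, ell_val]; omega
  · rw [chain_succ_eq]; rfl

theorem IsDominant.not_chain_append_chain {n a k : ℕ} (hk : 2*a + k + 1 ≤ 2*n+2)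
    {z y : List (Fin (n+2))} :
    ¬ IsDominant n (z ++ (chain n a (k+1) ++ chain n a (k+2)) ++ y) := by
  rintro ⟨u, hu, h⟩
  refine h.word_notMem hu ?_ ((serreRel_delEnd n).word_chain_append_chain_mem hk)
  rintro _ (⟨b, hb, rfl⟩ | rfl)
  · refine ⟨[], b, ell n a, [], (revTail n a k).reverse ++ chain n a (k+2), ?_, rfl, ?_⟩
    · rw [Fin.lt_def, ell_val]; omega
    · rw [chain_succ_eq n a k]; rfl
  · refine ⟨chain n a (k+1), ell n (a+k+1), ell n a, [], (revTail n a (k+1)).reverse, ?_, rfl, ?_⟩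
    · rw [Fin.lt_def, ell_val, ell_val]; omega
    · rw [chain_succ_eq n a (k+1)]

theorem chain_eq_map (n a k : ℕ) : chain n a k = (List.range k).map fun i => ell n (a+i) := by
  induction k with
  | zero => rfl
  | succ k ih => rw [chain, ih, List.range_succ, List.map_append, List.map_singleton]

theorem mem_chain {n a k : ℕ} {b : Fin (n+2)} : b ∈ chain n a k ↔ ∃ i < k, ell n (a+i) = b := by
  simp [chain_eq_map]

theorem chain_ne_nil {n a k : ℕ} (hk : 1 ≤ k) : chain n a k ≠ [] := by
  obtain ⟨k, rfl⟩ : ∃ m, k = m+1 := ⟨k-1, by omega⟩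
  simp [chain_succ]

theorem chain_prefix {n a s r : ℕ} (h : s ≤ r) : chain n a s <+: chain n a r := by
  induction r, h using Nat.le_induction with
  | base => exact List.prefix_refl _
  | succ r _ ih => exact ih.trans (List.prefix_append _ _)

theorem chain_add (n a k m : ℕ) : chain n a (k+m) = chain n a k ++ chain n (a+k) m := by
  induction m with
  | zero => simp [chain]
  | succ m ih => rw [← add_assoc, chain, ih, chain, List.append_assoc, add_assoc]

theorem chain_succ_eq_cons (n a k : ℕ) : chain n a (k+1) = ell n a :: chain n (a+1) k := by
  rw [add_comm k, chain_add]
  rfl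

theorem chain_reverse {n m : ℕ} (hm : m ≤ n+2) :
    (chain n (n+2-m) m).reverse = chain n (n+2) m := by
  induction m with
  | zero => rfl
  | succ m ih =>
    rw [chain_succ_eq_cons, List.reverse_cons, show n+2-(m+1)+1 = n+2-m by omega, ih (by omega),
      chain_succ, show ell n (n+2-(m+1)) = ell n (n+2+m) by rw [ell_inj]; omega]

theorem asc_eq_chain {n : ℕ} {i j : Fin (n+2)} (h : i ≤ j) :
    asc n i j = chain n i (j+1-i) := by
  rw [Fin.le_def] at h
  refine List.Pairwise.eq_of_mem_iff (r := (· < ·)) ((List.pairwise_lt_finRange _).filter _) ?_ ?_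
  · rw [chain_eq_map, List.pairwise_map]
    refine List.pairwise_lt_range.imp_of_mem fun {x y} hx hy hxy => ?_
    rw [List.mem_range] at hx hy
    rw [Fin.lt_def, ell_val, ell_val]
    omega
  · intro b
    simp only [asc, List.mem_filter, List.mem_finRange, true_and, decide_eq_true_eq, mem_chain]
    constructor
    · rintro ⟨h1, h2⟩
      rw [Fin.le_def] at h1 h2
      exact ⟨b - i, by omega, by rw [show (i : ℕ) + (b - i) = b by omega, ell_surj]⟩
    · rintro ⟨k, hk, rfl⟩
      simp only [Fin.le_def, ell_val]
      omega

theorem lynB_eq_chain {n : ℕ} {i j : Fin (n+2)} :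
    lynB n i j = chain n i (2*n+4-i-j) := by
  have h := chain_reverse (n := n) (m := n+2-j) (by omega)
  rw [show n+2-(n+2-(j : ℕ)) = j by omega] at h
  rw [lynB, asc_eq_chain (Fin.le_last i), asc_eq_chain (Fin.le_last j), Fin.val_last, h,
    show 2*n+4-(i : ℕ)-j = (n+1+1-i) + (n+2-j) by omega, chain_add,
    show (i : ℕ) + (n+1+1-i) = n+2 by omega]

theorem exists_eq_chain_iff {n : ℕ} {w : List (Fin (n+2))} :
    (∃ a k, 1 ≤ k ∧ 2*a + k ≤ 2*n+3 ∧ w = chain n a k) ↔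
      ((∃ i j : Fin (n+2), i ≤ j ∧ w = lynA n i j) ∨
        (∃ i j : Fin (n+2), i < j ∧ w = lynB n i j)) := by
  constructor
  · rintro ⟨a, k, hk, hak, rfl⟩
    by_cases h : a + k ≤ n+2
    · refine Or.inl ⟨⟨a, by omega⟩, ⟨a+k-1, by omega⟩, ?_, ?_⟩
      · rw [Fin.le_def]; simp only; omega
      · rw [lynA, asc_eq_chain (by rw [Fin.le_def]; simp only; omega)]
        simp only
        congr 1
        omega
    · refine Or.inr ⟨⟨a, by omega⟩, ⟨2*n+4-(a+k), by omega⟩, ?_, ?_⟩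
      · rw [Fin.lt_def]; simp only; omega
      · rw [lynB_eq_chain]
        simp only
        congr 1
        omega
  · rintro (⟨i, j, hij, rfl⟩ | ⟨i, j, hij, rfl⟩)
    · have h := hij
      rw [Fin.le_def] at h
      exact ⟨i, j+1-i, by omega, by omega, asc_eq_chain hij⟩
    · rw [Fin.lt_def] at hij
      exact ⟨i, 2*n+4-i-j, by omega, by omega, lynB_eq_chain⟩

theorem isDominant_chain {n a k : ℕ} (hk : 1 ≤ k) (hk' : 2*a + k ≤ 2*n+3) :
    IsDominant n (chain n a k) := by
  refine ⟨_, chain_mem hk hk', ?_⟩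
  simp [IsMaxWord, wd]

theorem isLyndonW_chain {n a k : ℕ} (hk : 1 ≤ k) (hk' : 2*a + k ≤ 2*n+3) :
    IsLyndonW n (chain n a k) := by
  refine ⟨chain_ne_nil hk, fun s t hst hs ht => ?_⟩
  obtain ⟨k, rfl⟩ : ∃ m, k = m+1 := ⟨k-1, by omega⟩
  obtain ⟨c, s, rfl⟩ := List.exists_cons_of_ne_nil hs
  obtain ⟨b, t, rfl⟩ := List.exists_cons_of_ne_nil ht
  rw [chain_succ_eq_cons] at hst ⊢
  obtain ⟨-, h⟩ := List.cons.inj hst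
  have hb : b ∈ chain n (a+1) k := by simp [h]
  obtain ⟨i, hi, rfl⟩ := mem_chain.1 hb
  refine List.Lex.rel ?_
  rw [Fin.lt_def, ell_val, ell_val]
  omega

theorem IsLyndonW.head_le {n : ℕ} {a b : Fin (n+2)} {w : List (Fin (n+2))}
    (h : IsLyndonW n (a :: w)) (hb : b ∈ w) : a ≤ b := by
  obtain ⟨s, t, rfl⟩ := List.append_of_mem hb
  have := h.2 (a :: s) (b :: t) rfl (by simp) (by simp)
  cases this with
  | cons _ => exact le_rfl
  | rel h => exact h.le

theorem not_wlt_of_prefix {n : ℕ} {v w : List (Fin (n+2))} (h : v <+: w) : ¬ wlt n w v := by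
  obtain ⟨t, rfl⟩ := h
  induction v with
  | nil => exact fun h => nomatch h
  | cons c v ih =>
    intro h
    cases h with
    | cons h => exact ih h
    | rel h => exact lt_irrefl _ h

/-- The possible shapes of the prefixes of a dominant Lyndon word with first letter `a`. -/
theorem IsDominant.prefix_eq {n a : ℕ} {w : List (Fin (n+2))} (hw : IsDominant n w)
    (ha : ∀ b ∈ w, a ≤ (b : ℕ)) (hhead : w.head? = some (ell n a)) (haN : a ≤ n+1)
    {v : List (Fin (n+2))} (hv : v ≠ []) (h : v <+: w) :
    (∃ s, 1 ≤ s ∧ 2*a + s ≤ 2*n+3 ∧ v = chain n a s) ∨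
      ∃ z r s, 1 ≤ s ∧ s ≤ r ∧ 2*a + r ≤ 2*n+3 ∧ v = z ++ chain n a r ++ chain n a s ∧
        chain n a r <+: z ++ chain n a r := by
  induction v using List.reverseRecOn with
  | nil => exact absurd rfl hv
  | append_singleton v c ih =>
    obtain ⟨y, rfl⟩ := h
    have hc : a ≤ (c : ℕ) := ha c (by simp)
    by_cases hnil : v = []
    · subst hnil
      obtain rfl : c = ell n a := by simpa using hhead
      exact Or.inl ⟨1, le_rfl, by omega, rfl⟩
    have hfac : ∀ {z s}, v = z ++ chain n a s → 1 ≤ s → 2*a + s ≤ 2*n+3 → a < (c : ℕ) →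
        c = ell n (a+s) := by
      rintro z s rfl hs hs' hac
      by_contra hne
      obtain ⟨k, rfl⟩ : ∃ k, s = k+1 := ⟨s-1, by omega⟩
      refine IsDominant.not_chain_snoc (n := n) (a := a) (c := c) (k := k) hac (by omega)
        (by omega) (by rwa [ell_surj]) (z := z) (y := y) ?_
      simpa [ell_surj] using hw
    have hca : ¬ a < (c : ℕ) → [c] = chain n a 1 := by
      intro h
      rw [chain, chain, ← ell_surj c, show (c : ℕ) = a + 0 by omega]
      rfl
    rcases ih hnil ⟨[c] ++ y, by simp⟩ with ⟨s, hs, hs', rfl⟩ | ⟨z, r, s, hs, hsr, hr, rfl, hpre⟩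
    · by_cases hac : a < (c : ℕ)
      · obtain rfl := hfac (List.nil_append _).symm hs hs' hac
        rw [ell_val] at hac
        exact Or.inl ⟨s+1, by omega, by omega, rfl⟩
      · exact Or.inr ⟨[], s, 1, le_rfl, hs, hs', by rw [hca hac]; rfl, List.prefix_refl _⟩
    · by_cases hac : a < (c : ℕ)
      · obtain rfl := hfac rfl hs (by omega) hac
        rw [ell_val] at hac
        rcases hsr.lt_or_eq with hlt | rfl
        · exact Or.inr ⟨z, r, s+1, by omega, hlt, hr, by rw [chain_succ, List.append_assoc], hpre⟩
        · obtain ⟨k, rfl⟩ : ∃ k, s = k+1 := ⟨s-1, by omega⟩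
          refine absurd ?_ (IsDominant.not_chain_append_chain (n := n) (a := a) (k := k) (by omega)
            (z := z) (y := y))
          rw [chain_succ n a (k+1)]
          simpa using hw
      · refine Or.inr ⟨z ++ chain n a r, s, 1, le_rfl, hs, by omega, by rw [hca hac], ?_⟩
        exact ((chain_prefix hsr).trans hpre).trans (List.prefix_append _ _)

theorem IsDominant.exists_eq_chain {n : ℕ} {w : List (Fin (n+2))} (hw : IsDominant n w)
    (hl : IsLyndonW n w) : ∃ a k, 1 ≤ k ∧ 2*a + k ≤ 2*n+3 ∧ w = chain n a k := by
  obtain ⟨a, w, rfl⟩ := List.exists_cons_of_ne_nil hl.1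
  have ha : ∀ b ∈ a :: w, (a : ℕ) ≤ (b : ℕ) := by
    intro b hb
    rcases List.mem_cons.1 hb with rfl | hb
    · exact le_rfl
    · exact hl.head_le hb
  rcases hw.prefix_eq ha (by rw [ell_surj]; rfl) (by omega) hl.1 (List.prefix_refl _) with
    ⟨s, hs⟩ | ⟨z, r, s, hs, hsr, hr, hw', hpre⟩
  · exact ⟨a, s, hs⟩
  · have hlt := hl.2 _ _ hw' (List.append_ne_nil_of_right_ne_nil _ (chain_ne_nil (by omega)))
      (chain_ne_nil hs)
    refine absurd hlt (not_wlt_of_prefix ?_)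
    rw [hw']
    exact ((chain_prefix hsr).trans hpre).trans (List.prefix_append _ _)

/-- The set of dominant Lyndon words is exactly
`{(i,…,j) : i ≤ j} ∪ {(i,…,n,n,…,j) : i < j}`. -/
theorem stmt6 (n : ℕ) (w : List (Fin (n+2))) :
    (IsDominant n w ∧ IsLyndonW n w) ↔
      ((∃ i j : Fin (n+2), i ≤ j ∧ w = lynA n i j) ∨
        (∃ i j : Fin (n+2), i < j ∧ w = lynB n i j)) := by
  rw [← exists_eq_chain_iff]
  constructor
  · rintro ⟨hw, hl⟩
    exact hw.exists_eq_chain hl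
  · rintro ⟨a, k, hk, hk', rfl⟩
    exact ⟨isDominant_chain hk hk', isLyndonW_chain hk hk'⟩

end SpinQHA
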